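/- Let m₁, m₂ > 0 and let (a_n), (b_n) be sequences of nonnegative integers with a_n/n → m₁ and b_n/n → m₂. Set Q_n(x) := x^{a_n}·(x+1)^{b_n}. Then for every 0 ≤ t < m₁+m₂, the empirical root measures (1/n)·∑_{z: Q_n^{([tn])}(z)=0} δ_z (roots counted with multiplicity) converge weakly as n→∞ to the finite measure μ_t on [−1,0] given by μ_t(dx) = (m₁+m₂)·√((x₊(t)−x)(x−x₋(t))) / (2π·|x|·(1+x)) · 1_{x₋(t)<x<x₊(t)} dx + (m₁−t)·1_{t<m₁}·δ₀ + (m₂−t)·1_{t<m₂}·δ_{−1}, where x_±(t) = [(t−m₁)m₁ − m₂(t+m₁) ± 2√(m₁m₂·t·(m₁+m₂−t))] / (m₁+m₂)². -/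

import Mathlib

open MeasureTheory Filter Polynomial

open scoped ENNReal

/-- The empirical measure of the roots (counted with multiplicity) of a real polynomial,
normalized by `1/n`. -/
noncomputable def empRootMeasure (n : ℕ) (p : Polynomial ℝ) : Measure ℝ :=
  ((n : ℝ≥0∞))⁻¹ • (p.roots.map Measure.dirac).sum

/-- The endpoints `x₋(t) ≤ x₊(t)` of the support of the absolutely continuous part of the
limiting zero distribution for initial condition `m₁·δ₀ + m₂·δ₋₁`. -/
noncomputable def xMinus (m₁ m₂ t : ℝ) : ℝ :=
  ((t - m₁) * m₁ - m₂ * (t + m₁) - 2 * Real.sqrt (m₁ * m₂ * t * (m₁ + m₂ - t))) / (m₁ + m₂) ^ 2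

noncomputable def xPlus (m₁ m₂ t : ℝ) : ℝ :=
  ((t - m₁) * m₁ - m₂ * (t + m₁) + 2 * Real.sqrt (m₁ * m₂ * t * (m₁ + m₂ - t))) / (m₁ + m₂) ^ 2

/-- The limiting zero distribution at time `t` of the `⌊tn⌋`-th derivative of
`x^{m₁n+o(n)}(x+1)^{m₂n+o(n)}`: an absolutely continuous part on `(x₋(t), x₊(t))` plus
atoms `(m₁−t)·δ₀` (if `t < m₁`) and `(m₂−t)·δ₋₁` (if `t < m₂`). -/
noncomputable def limitZeroMeasure (m₁ m₂ t : ℝ) : Measure ℝ :=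
  MeasureTheory.volume.withDensity (fun x => ENNReal.ofReal
      (Set.indicator (Set.Ioo (xMinus m₁ m₂ t) (xPlus m₁ m₂ t))
        (fun x => (m₁ + m₂) * Real.sqrt ((xPlus m₁ m₂ t - x) * (x - xMinus m₁ m₂ t)) /
          (2 * Real.pi * |x| * (1 + x))) x))
    + (if t < m₁ then ENNReal.ofReal (m₁ - t) else 0) • Measure.dirac (0 : ℝ)
    + (if t < m₂ then ENNReal.ofReal (m₂ - t) else 0) • Measure.dirac (-1 : ℝ)

lemma semicircle_primitive_hasDerivAt {α β z x : ℝ} (hαx : α < x) (hxβ : x < β) (hβz : β ≤ z) :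
    HasDerivAt (fun x => -√((β - x) * (x - α))
        + (z - (α + β) / 2) * Real.arcsin ((2 * x - (α + β)) / (β - α))
        - √((z - α) * (z - β)) * Real.arcsin ((2 * ((z - α) * (z - β))
          - (z - x) * ((z - α) + (z - β))) / ((z - x) * (β - α))))
      (√((β - x) * (x - α)) / (z - x)) x := by
  have hR : 0 < (β - x) * (x - α) := mul_pos (by linarith) (by linarith)
  have hS : 0 < √((β - x) * (x - α)) := Real.sqrt_pos.2 hR
  have hSS : √((β - x) * (x - α)) ^ 2 = (β - x) * (x - α) := Real.sq_sqrt hR.le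
  have hw : 0 < z - x := by linarith
  have hr : 0 < β - α := by linarith
  have hsqrt : HasDerivAt (fun x => √((β - x) * (x - α)))
      ((α + β - 2 * x) / (2 * √((β - x) * (x - α)))) x := by
    have h : HasDerivAt (fun x => (β - x) * (x - α)) (α + β - 2 * x) x := by
      refine (((hasDerivAt_id x).const_sub β).mul ((hasDerivAt_id x).sub_const α)).congr_deriv ?_
      simp only [id]
      ring
    exact h.sqrt hR.ne'
  have harc : HasDerivAt (fun x => Real.arcsin ((2 * x - (α + β)) / (β - α)))
      (1 / √((β - x) * (x - α))) x := by
    have hu : HasDerivAt (fun x => (2 * x - (α + β)) / (β - α)) (2 / (β - α)) x := by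
      simpa using (((hasDerivAt_id x).const_mul 2).sub_const (α + β)).div_const (β - α)
    have h := (Real.hasDerivAt_arcsin (x := (2 * x - (α + β)) / (β - α)) (by
      rw [Ne, div_eq_iff hr.ne']; intro h; linarith) (by
      rw [Ne, div_eq_iff hr.ne']; intro h; linarith)).comp x hu
    have he : √(1 - ((2 * x - (α + β)) / (β - α)) ^ 2)
        = 2 * √((β - x) * (x - α)) / (β - α) := by
      rw [Real.sqrt_eq_iff_mul_self_eq_of_pos (by positivity)]
      field_simp
      rw [hSS]; ring
    refine h.congr_deriv ?_
    rw [he]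
    field_simp
  have harc' : HasDerivAt (fun x => √((z - α) * (z - β)) * Real.arcsin ((2 * ((z - α) * (z - β))
          - (z - x) * ((z - α) + (z - β))) / ((z - x) * (β - α))))
      ((z - α) * (z - β) / ((z - x) * √((β - x) * (x - α)))) x := by
    rcases hβz.eq_or_lt with rfl | hz
    · simpa using hasDerivAt_const x (0 : ℝ)
    have hpq : 0 < (z - α) * (z - β) := mul_pos (by linarith) (by linarith)
    have hs : 0 < √((z - α) * (z - β)) := Real.sqrt_pos.2 hpq
    have hss : √((z - α) * (z - β)) ^ 2 = (z - α) * (z - β) := Real.sq_sqrt hpq.le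
    set h0 := (2 * ((z - α) * (z - β))
          - (z - x) * ((z - α) + (z - β))) / ((z - x) * (β - α)) with hh0
    have hone : 1 - h0 ^ 2 =
        (2 * √((z - α) * (z - β)) * √((β - x) * (x - α)) / ((z - x) * (β - α))) ^ 2 := by
      rw [hh0]
      field_simp
      rw [hSS, hss]; ring
    have hpos : 0 < 1 - h0 ^ 2 := by rw [hone]; positivity
    have hu : HasDerivAt (fun x => (2 * ((z - α) * (z - β))
          - (z - x) * ((z - α) + (z - β))) / ((z - x) * (β - α)))
          (2 * ((z - α) * (z - β)) / ((z - x) ^ 2 * (β - α))) x := by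
      have hd : HasDerivAt (fun x => z - x) (-1) x := by
        simpa using (hasDerivAt_id x).const_sub z
      refine (((hd.mul_const ((z - α) + (z - β))).const_sub (2 * ((z - α) * (z - β)))).div
        (hd.mul_const (β - α)) (by positivity)).congr_deriv ?_
      field_simp
      ring
    have h := ((Real.hasDerivAt_arcsin (x := h0) (by rintro h; rw [h] at hpos; norm_num at hpos)
      (by rintro h; rw [h] at hpos; norm_num at hpos)).comp x hu).const_mul √((z - α) * (z - β))
    refine h.congr_deriv ?_
    rw [hone, Real.sqrt_sq (by positivity)]
    field_simp
  refine ((hsqrt.neg.add (harc.const_mul (z - (α + β) / 2))).sub harc').congr_deriv ?_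
  field_simp
  rw [hSS]
  ring

lemma semicircle_stieltjes_right {α β z : ℝ} (hαβ : α ≤ β) (hβz : β ≤ z) :
    IntervalIntegrable (fun x => √((β - x) * (x - α)) / (z - x)) volume α β ∧
    ∫ x in α..β, √((β - x) * (x - α)) / (z - x)
      = Real.pi * (z - (α + β) / 2 - √((z - α) * (z - β))) := by
  rcases hαβ.eq_or_lt with rfl | hlt
  · refine ⟨by simp, ?_⟩
    rw [intervalIntegral.integral_same, ← sq, Real.sqrt_sq (by linarith)]
    ring
  set F : ℝ → ℝ := fun x => -√((β - x) * (x - α))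
        + (z - (α + β) / 2) * Real.arcsin ((2 * x - (α + β)) / (β - α))
        - √((z - α) * (z - β)) * Real.arcsin ((2 * ((z - α) * (z - β))
          - (z - x) * ((z - α) + (z - β))) / ((z - x) * (β - α))) with hF
  have hcont : ContinuousOn F (Set.Icc α β) := by
    refine ContinuousOn.sub (by fun_prop) ?_
    rcases hβz.eq_or_lt with rfl | hz
    · simpa using continuousOn_const
    refine continuousOn_const.mul (Real.continuous_arcsin.comp_continuousOn ?_)
    refine ContinuousOn.div (by fun_prop) (by fun_prop) fun x hx => ?_
    exact (mul_pos (by linarith [hx.2]) (by linarith)).ne'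
  have hderiv : ∀ x ∈ Set.Ioo α β, HasDerivAt F (√((β - x) * (x - α)) / (z - x)) x :=
    fun x hx => semicircle_primitive_hasDerivAt hx.1 hx.2 hβz
  have hint : IntervalIntegrable (fun x => √((β - x) * (x - α)) / (z - x)) volume α β := by
    rw [intervalIntegrable_iff_integrableOn_Ioc_of_le hαβ]
    refine intervalIntegral.integrableOn_deriv_of_nonneg hcont hderiv fun x hx => ?_
    exact div_nonneg (Real.sqrt_nonneg _) (by linarith [hx.2])
  refine ⟨hint, ?_⟩
  rw [intervalIntegral.integral_eq_sub_of_hasDerivAt_of_le hαβ hcont hderiv hint]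
  have hr : β - α ≠ 0 := by linarith
  have hp : z - α ≠ 0 := by linarith
  have e1 : (2 * β - (α + β)) / (β - α) = 1 := by field_simp; ring
  have e2 : (2 * α - (α + β)) / (β - α) = -1 := by field_simp; ring
  have e3 : (2 * ((z - α) * (z - β)) - (z - α) * ((z - α) + (z - β))) / ((z - α) * (β - α)) = -1 := by
    field_simp; ring
  simp only [hF, e1, e2, e3, sub_self, zero_mul, mul_zero, Real.sqrt_zero, Real.arcsin_one,
    Real.arcsin_neg_one]
  rcases hβz.eq_or_lt with rfl | hz
  · simp; ring
  have hq : z - β ≠ 0 := by linarith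
  have e4 : (2 * ((z - α) * (z - β)) - (z - β) * ((z - α) + (z - β))) / ((z - β) * (β - α)) = 1 := by
    field_simp; ring
  rw [e4, Real.arcsin_one]
  ring

lemma semicircle_stieltjes_left {α β z : ℝ} (hαβ : α ≤ β) (hzα : z ≤ α) :
    IntervalIntegrable (fun x => √((β - x) * (x - α)) / (x - z)) volume α β ∧
    ∫ x in α..β, √((β - x) * (x - α)) / (x - z)
      = Real.pi * ((α + β) / 2 - z - √((α - z) * (β - z))) := by
  obtain ⟨h1, h2⟩ := semicircle_stieltjes_right (neg_le_neg hαβ) (neg_le_neg hzα)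
  have he : (fun x => √((-α - -x) * (-x - -β)) / (-z - -x))
      = fun x => √((β - x) * (x - α)) / (x - z) := by
    funext x
    rw [show (-α - -x) * (-x - -β) = (β - x) * (x - α) by ring, show -z - -x = x - z by ring]
  constructor
  · have := ((IntervalIntegrable.iff_comp_neg).1 h1).symm
    rwa [he, neg_neg, neg_neg] at this
  · have := intervalIntegral.integral_comp_neg (a := α) (b := β)
      (fun x => √((-α - x) * (x - -β)) / (-z - x))
    rw [h2] at this
    rw [he] at this
    rw [this]
    congr 1
    ring_nf

lemma splits_derivative {p : ℝ[X]} (hp : p.Splits) : (derivative p).Splits := by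
  rw [splits_iff_card_roots] at hp ⊢
  have h1 := card_roots_le_derivative p
  have h2 := (derivative p).card_roots'
  have h3 := natDegree_derivative_le p
  rcases Nat.eq_zero_or_pos p.natDegree with h | h
  · rw [natDegree_eq_zero.1 h |>.choose_spec.symm]; simp
  · omega

lemma roots_derivative_mem_Icc {p : ℝ[X]} (hp : p.Splits) {α β : ℝ}
    (hr : ∀ r ∈ p.roots, r ∈ Set.Icc α β) : ∀ r ∈ (derivative p).roots, r ∈ Set.Icc α β := by
  intro x hx
  have hp' : derivative p ≠ 0 := ne_zero_of_mem_roots hx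
  have hp0 : p ≠ 0 := by rintro rfl; simp at hp'
  have hroots : p.roots ≠ 0 := by
    intro h
    have := splits_iff_card_roots.1 hp
    rw [h, Multiset.card_zero] at this
    exact hp' (derivative_of_natDegree_zero this.symm)
  have hx0 : (derivative p).eval x = 0 := (mem_roots hp').1 hx
  by_cases hpx : p.eval x = 0
  · exact hr x ((mem_roots hp0).2 hpx)
  rw [hp.eval_derivative_eq_eval_mul_sum hpx] at hx0
  replace hx0 := (mul_eq_zero.1 hx0).resolve_left hpx
  constructor
  · by_contra! hlt
    have : (p.roots.map fun r => 1 / (x - r)).sum < (p.roots.map fun _ => (0 : ℝ)).sum :=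
      Multiset.sum_lt_sum_of_nonempty hroots fun r h =>
        one_div_neg.2 (by linarith [(hr r h).1])
    simp [-one_div] at this
    linarith
  · by_contra! hlt
    have : (p.roots.map fun _ => (0 : ℝ)).sum < (p.roots.map fun r => 1 / (x - r)).sum :=
      Multiset.sum_lt_sum_of_nonempty hroots fun r h =>
        one_div_pos.2 (by linarith [(hr r h).2])
    simp [-one_div] at this
    linarith

lemma splits_and_roots_iterate_derivative {p : ℝ[X]} (hp : p.Splits) {α β : ℝ}
    (hr : ∀ r ∈ p.roots, r ∈ Set.Icc α β) (k : ℕ) :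
    (derivative^[k] p).Splits ∧ ∀ r ∈ (derivative^[k] p).roots, r ∈ Set.Icc α β := by
  induction k with
  | zero => exact ⟨hp, hr⟩
  | succ k ih =>
    rw [Function.iterate_succ_apply']
    exact ⟨splits_derivative ih.1, roots_derivative_mem_Icc ih.1 ih.2⟩

lemma eval_derivative_derivative_of_splits {p : ℝ[X]} (hp : p.Splits) {z : ℝ} (hz : p.eval z ≠ 0) :
    (derivative (derivative p)).eval z = p.eval z *
      ((p.roots.map fun r => 1 / (z - r)).sum ^ 2 - (p.roots.map fun r => 1 / (z - r) ^ 2).sum) := by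
  have hp0 : p ≠ 0 := by rintro rfl; simp at hz
  have key : ∀ s : Multiset ℝ, (∀ r ∈ s, z ≠ r) →
      HasDerivAt (fun x => (s.map fun r => 1 / (x - r)).sum)
        (-(s.map fun r => 1 / (z - r) ^ 2).sum) z := by
    intro s
    induction s using Multiset.induction with
    | empty => intro _; simpa using hasDerivAt_const z (0 : ℝ)
    | cons a s ih =>
      intro h
      have h1 : z - a ≠ 0 := sub_ne_zero.2 (h a (Multiset.mem_cons_self a s))
      have h2 := ((hasDerivAt_id z).sub_const a).inv h1
      have := h2.add (ih fun r hr => h r (Multiset.mem_cons_of_mem hr))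
      simp only [Multiset.map_cons, Multiset.sum_cons, one_div] at this ⊢
      refine this.congr_deriv ?_
      simp only [id]
      ring
  have hev : ∀ᶠ x in nhds z, p.eval x ≠ 0 := p.continuous.continuousAt.eventually_ne hz
  have heq : (fun x => (derivative p).eval x) =ᶠ[nhds z]
      fun x => p.eval x * (p.roots.map fun r => 1 / (x - r)).sum := by
    filter_upwards [hev] with x hx using hp.eval_derivative_eq_eval_mul_sum hx
  have hd := ((p.hasDerivAt z).mul (key p.roots fun r hr h => hz (by
    rw [h]; exact (mem_roots hp0).1 hr))).congr_of_eventuallyEq heq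
  rw [((derivative p).hasDerivAt z).unique hd, hp.eval_derivative_eq_eval_mul_sum hz]
  ring

lemma iterate_derivative_X_pow_mul_ode (a b k : ℕ) (y : ℕ → ℝ[X])
    (hy : ∀ k, y k = derivative^[k] (X ^ a * (X + 1) ^ b)) :
    X * (X + 1) * y (k + 2) + (C ((k : ℝ) + 1) * (2 * X + 1) - C (a : ℝ) * (X + 1) - C (b : ℝ) * X)
      * y (k + 1) + C (((k : ℝ) + 1) * (k - a - b)) * y k = 0 := by
  have hs : ∀ k, derivative (y k) = y (k + 1) := fun k => by
    rw [hy, hy, Function.iterate_succ_apply']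
  have h0 : X * (X + 1) * y 1 - (C (a : ℝ) * (X + 1) + C (b : ℝ) * X) * y 0 = 0 := by
    rw [← hs 0, hy 0]
    simp only [Function.iterate_zero, id, derivative_mul, derivative_pow,
      derivative_add, derivative_X, derivative_one]
    rcases a with _ | a <;> rcases b with _ | b <;> simp <;> ring
  induction k with
  | zero =>
    have h := congrArg derivative h0
    simp only [derivative_mul, derivative_sub, derivative_add, derivative_X, derivative_one,
      derivative_C, hs, derivative_zero] at h
    simp only [map_add, map_sub, map_mul, map_one, map_zero, Nat.cast_zero, Nat.reduceAdd] at h ⊢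
    linear_combination h
  | succ k ih =>
    have h := congrArg derivative ih
    simp only [derivative_mul, derivative_sub, derivative_add, derivative_X, derivative_one,
      derivative_C, hs, derivative_zero, derivative_ofNat] at h
    simp only [map_add, map_sub, map_mul, map_one, Nat.cast_add, Nat.cast_one] at h ⊢
    linear_combination h

lemma integrable_of_continuousOn_Icc {μ : Measure ℝ} [IsFiniteMeasure μ] {α β : ℝ}
    (hμ : ∀ᵐ x ∂μ, x ∈ Set.Icc α β) {f : ℝ → ℝ} (hf : ContinuousOn f (Set.Icc α β)) :
    Integrable f μ := by
  have := hf.integrableOn_compact (μ := μ) isCompact_Icc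
  rwa [IntegrableOn, Measure.restrict_eq_self_of_ae_mem hμ] at this

lemma abs_integral_sub_le_of_near {μ : Measure ℝ} [IsFiniteMeasure μ] {α β ε : ℝ}
    (hμ : ∀ᵐ x ∂μ, x ∈ Set.Icc α β) {f g : ℝ → ℝ} (hf : ContinuousOn f (Set.Icc α β))
    (hg : ContinuousOn g (Set.Icc α β)) (h : ∀ x ∈ Set.Icc α β, |f x - g x| ≤ ε) :
    |∫ x, f x ∂μ - ∫ x, g x ∂μ| ≤ ε * μ.real Set.univ := by
  rw [← integral_sub (integrable_of_continuousOn_Icc hμ hf) (integrable_of_continuousOn_Icc hμ hg)]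
  exact norm_integral_le_of_norm_le_const (f := fun x => f x - g x) (hμ.mono fun x hx => h x hx)

lemma tendsto_integral_of_near {ν : ℕ → Measure ℝ} {μ : Measure ℝ} [IsFiniteMeasure μ] {α β K : ℝ}
    (hμ : ∀ᵐ x ∂μ, x ∈ Set.Icc α β)
    (hν : ∀ᶠ n in atTop, IsFiniteMeasure (ν n) ∧ (∀ᵐ x ∂ν n, x ∈ Set.Icc α β) ∧
      (ν n).real Set.univ ≤ K)
    {f : ℝ → ℝ} (hf : ContinuousOn f (Set.Icc α β))
    (h : ∀ ε > 0, ∃ g : ℝ → ℝ, ContinuousOn g (Set.Icc α β) ∧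
      (∀ x ∈ Set.Icc α β, |f x - g x| ≤ ε) ∧
      Tendsto (fun n => ∫ x, g x ∂ν n) atTop (nhds (∫ x, g x ∂μ))) :
    Tendsto (fun n => ∫ x, f x ∂ν n) atTop (nhds (∫ x, f x ∂μ)) := by
  have hK : 0 ≤ K := by
    obtain ⟨n, hn⟩ := hν.exists
    exact measureReal_nonneg.trans hn.2.2
  rw [Metric.tendsto_atTop']
  have hM : 0 ≤ μ.real Set.univ := measureReal_nonneg
  intro ε hε
  obtain ⟨g, hg, hfg, hlim⟩ := h (ε / (2 * (K + μ.real Set.univ + 1))) (by positivity)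
  set δ := ε / (2 * (K + μ.real Set.univ + 1)) with hδ
  have hδ0 : 0 < δ := by positivity
  have hδε : δ * (K + μ.real Set.univ + 1) = ε / 2 := by rw [hδ]; field_simp
  have hev := (Metric.tendsto_nhds.1 hlim (ε / 2) (by positivity)).and hν
  obtain ⟨N, hN⟩ := eventually_atTop.1 hev
  refine ⟨N, fun n hn => ?_⟩
  obtain ⟨h1, h2, h3, h4⟩ := hN n hn.le
  have e1 := abs_integral_sub_le_of_near h3 hf hg hfg
  have e2 := abs_integral_sub_le_of_near hμ hf hg hfg
  rw [Real.dist_eq] at h1 ⊢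
  have e3 : δ * (ν n).real Set.univ ≤ δ * K := by gcongr
  rw [abs_le] at e1 e2
  rw [abs_lt] at h1 ⊢
  constructor <;> nlinarith

lemma geom_remainder {s x : ℝ} (j : ℕ) (h : 1 - s * x ≠ 0) :
    1 / (1 - s * x) - ∑ i ∈ Finset.range j, s ^ i * x ^ i = s ^ j * (x ^ j / (1 - s * x)) := by
  have := geom_sum_mul (s * x) j
  simp only [mul_pow] at this
  field_simp
  linear_combination this

lemma tendsto_integral_of_stieltjes {ν : ℕ → Measure ℝ} {μ : Measure ℝ} [IsFiniteMeasure μ] {K : ℝ}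
    (hμ : ∀ᵐ x ∂μ, x ∈ Set.Icc (-1 : ℝ) 0)
    (hν : ∀ᶠ n in atTop, IsFiniteMeasure (ν n) ∧ (∀ᵐ x ∂ν n, x ∈ Set.Icc (-1 : ℝ) 0) ∧
      (ν n).real Set.univ ≤ K)
    (h : ∀ z : ℝ, 0 < z →
      Tendsto (fun n => ∫ x, 1 / (z - x) ∂ν n) atTop (nhds (∫ x, 1 / (z - x) ∂μ)))
    {f : ℝ → ℝ} (hf : Continuous f) :
    Tendsto (fun n => ∫ x, f x ∂ν n) atTop (nhds (∫ x, f x ∂μ)) := by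
  have hmon : ∀ j : ℕ, Tendsto (fun n => ∫ x, x ^ j ∂ν n) atTop (nhds (∫ x, x ^ j ∂μ)) := by
    intro j
    induction j using Nat.strong_induction_on with
    | _ j ih =>
      refine tendsto_integral_of_near hμ hν (by fun_prop) fun s hs => ?_
      have hpos : ∀ x ∈ Set.Icc (-1 : ℝ) 0, 0 < 1 - s * x := fun x hx => by nlinarith [hx.1, hx.2]
      have hcz : ContinuousOn (fun x : ℝ => 1 / (1 / s - x)) (Set.Icc (-1) 0) := by
        refine continuousOn_const.div (by fun_prop) fun x hx => ?_
        have : 0 < 1 / s := by positivity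
        linarith [hx.2]
      set g : ℝ → ℝ := fun x => (1 / s ^ j) * ((1 / s) * (1 / (1 / s - x))
        - ∑ i ∈ Finset.range j, s ^ i * x ^ i) with hg
      have hgeq : ∀ x ∈ Set.Icc (-1 : ℝ) 0, g x = x ^ j / (1 - s * x) := by
        intro x hx
        have h1 := (hpos x hx).ne'
        have h2 : (1 / s) * (1 / (1 / s - x)) = 1 / (1 - s * x) := by
          rw [div_mul_div_comm, one_mul, mul_sub, mul_one_div_cancel hs.ne']
        simp only [hg]
        rw [h2, geom_remainder j h1]
        field_simp
      refine ⟨g, by fun_prop, fun x hx => ?_, ?_⟩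
      · rw [hgeq x hx]
        have h1 := hpos x hx
        have : x ^ j - x ^ j / (1 - s * x) = x ^ j * (s * (-x) / (1 - s * x)) := by
          field_simp; ring
        rw [this, abs_mul, abs_pow]
        have hx1 : |x| ≤ 1 := abs_le.2 ⟨hx.1, by linarith [hx.2]⟩
        have hx2 : |s * -x / (1 - s * x)| ≤ s := by
          rw [abs_of_nonneg (div_nonneg (mul_nonneg hs.le (by linarith [hx.2])) h1.le),
            div_le_iff₀ h1]
          nlinarith [hx.1, hx.2, mul_nonneg hs.le (neg_nonneg.2 hx.2),
            mul_nonneg hs.le (mul_nonneg hs.le (neg_nonneg.2 hx.2))]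
        calc |x| ^ j * |s * -x / (1 - s * x)| ≤ 1 * s := by
              gcongr; exact pow_le_one₀ (abs_nonneg _) hx1
          _ = s := one_mul s
      · have hint : ∀ (ρ : Measure ℝ), IsFiniteMeasure ρ → (∀ᵐ x ∂ρ, x ∈ Set.Icc (-1 : ℝ) 0) →
            ∫ x, g x ∂ρ = (1 / s ^ j) * ((1 / s) * ∫ x, 1 / (1 / s - x) ∂ρ
              - ∑ i ∈ Finset.range j, s ^ i * ∫ x, x ^ i ∂ρ) := by
          intro ρ _ hρ
          have hi : ∀ i ∈ Finset.range j, Integrable (fun x : ℝ => s ^ i * x ^ i) ρ := fun i _ =>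
            integrable_of_continuousOn_Icc hρ (by fun_prop)
          rw [hg, integral_const_mul, integral_sub, integral_const_mul, integral_finsetSum _ hi]
          · simp_rw [integral_const_mul]
          · exact (integrable_of_continuousOn_Icc hρ hcz).const_mul _
          · exact integrable_finsetSum _ hi
        rw [hint μ inferInstance hμ]
        have hT : Tendsto (fun n => (1 / s ^ j) * ((1 / s) * ∫ x, 1 / (1 / s - x) ∂ν n
              - ∑ i ∈ Finset.range j, s ^ i * ∫ x, x ^ i ∂ν n)) atTop
            (nhds ((1 / s ^ j) * ((1 / s) * ∫ x, 1 / (1 / s - x) ∂μ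
              - ∑ i ∈ Finset.range j, s ^ i * ∫ x, x ^ i ∂μ))) := by
          refine (((h (1 / s) (by positivity)).const_mul _).sub
            (tendsto_finsetSum _ fun i hi => ?_)).const_mul _
          exact (ih i (Finset.mem_range.1 hi)).const_mul _
        refine hT.congr' ?_
        filter_upwards [hν] with n hn using (hint _ hn.1 hn.2.1).symm
  refine tendsto_integral_of_near hμ hν hf.continuousOn fun ε hε => ?_
  obtain ⟨p, hp⟩ := exists_polynomial_near_of_continuousOn (-1) 0 f hf.continuousOn ε hε
  refine ⟨fun x => p.eval x, p.continuous.continuousOn, fun x hx => ?_, ?_⟩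
  · rw [abs_sub_comm]; exact (hp x hx).le
  · have hint : ∀ (ρ : Measure ℝ), IsFiniteMeasure ρ → (∀ᵐ x ∂ρ, x ∈ Set.Icc (-1 : ℝ) 0) →
        ∫ x, p.eval x ∂ρ = ∑ i ∈ Finset.range (p.natDegree + 1), p.coeff i * ∫ x, x ^ i ∂ρ := by
      intro ρ _ hρ
      simp_rw [eval_eq_sum_range]
      rw [integral_finsetSum _ fun i _ => integrable_of_continuousOn_Icc hρ (by fun_prop)]
      simp_rw [integral_const_mul]
    rw [hint μ inferInstance hμ]
    refine (tendsto_finsetSum _ fun i _ => (hmon i).const_mul _).congr' ?_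
    filter_upwards [hν] with n hn using (hint _ hn.1 hn.2.1).symm

/-- The endpoints of the support lie in `[-1, 0]` and are the roots of the discriminant. -/
lemma xMinus_xPlus_spec {m₁ m₂ t : ℝ} (hm₁ : 0 < m₁) (hm₂ : 0 < m₂) (ht0 : 0 ≤ t)
    (htm : t < m₁ + m₂) :
    xMinus m₁ m₂ t ≤ xPlus m₁ m₂ t ∧ -1 ≤ xMinus m₁ m₂ t ∧ xPlus m₁ m₂ t ≤ 0 ∧
    ∀ z, (m₁ + m₂) ^ 2 * ((z - xMinus m₁ m₂ t) * (z - xPlus m₁ m₂ t)) =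
      (t * (2 * z + 1) - m₁ * (z + 1) - m₂ * z) ^ 2
        - 4 * (z * (z + 1)) * (t * (t - (m₁ + m₂))) := by
  have hM : 0 < m₁ + m₂ := by positivity
  have hle : xMinus m₁ m₂ t ≤ xPlus m₁ m₂ t := by
    unfold xMinus xPlus
    gcongr
    linarith [Real.sqrt_nonneg (m₁ * m₂ * t * (m₁ + m₂ - t))]
  have hprod : ∀ z, (m₁ + m₂) ^ 2 * ((z - xMinus m₁ m₂ t) * (z - xPlus m₁ m₂ t)) =
      (t * (2 * z + 1) - m₁ * (z + 1) - m₂ * z) ^ 2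
        - 4 * (z * (z + 1)) * (t * (t - (m₁ + m₂))) := by
    intro z
    have hs : √(m₁ * m₂ * t * (m₁ + m₂ - t)) ^ 2 = m₁ * m₂ * t * (m₁ + m₂ - t) :=
      Real.sq_sqrt (mul_nonneg (by positivity) (by linarith))
    unfold xMinus xPlus
    field_simp
    linear_combination (-4) * hs
  have hsum : (m₁ + m₂) ^ 2 * (xMinus m₁ m₂ t + xPlus m₁ m₂ t) =
      2 * ((t - m₁) * m₁ - m₂ * (t + m₁)) := by
    unfold xMinus xPlus
    field_simp
    ring
  have hM2 : 0 < (m₁ + m₂) ^ 2 := by positivity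
  have h0 := hprod 0
  have h1 := hprod (-1)
  have hneg : xMinus m₁ m₂ t + xPlus m₁ m₂ t < 0 := by
    rcases le_total m₁ m₂ with h | h <;> by_contra! hc <;>
      nlinarith [mul_nonneg hM2.le hc, mul_pos hm₁ hM, mul_pos hm₂ hM]
  have hneg' : 0 < (xMinus m₁ m₂ t + 1) + (xPlus m₁ m₂ t + 1) := by
    by_contra! hc
    rcases le_total m₁ m₂ with h | h <;>
      nlinarith [mul_nonneg hM2.le (neg_nonneg.2 hc), mul_pos hm₁ hM, mul_pos hm₂ hM]
  refine ⟨hle, ?_, ?_, hprod⟩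
  · by_contra! hc
    have h2 : (-1 - xMinus m₁ m₂ t) * (-1 - xPlus m₁ m₂ t) < 0 :=
      mul_neg_of_pos_of_neg (by linarith) (by linarith)
    nlinarith [mul_neg_of_pos_of_neg hM2 h2, sq_nonneg (t * (2 * (-1) + 1) - m₁ * (-1 + 1) - m₂ * (-1))]
  · by_contra! hc
    have h2 : (0 - xMinus m₁ m₂ t) * (0 - xPlus m₁ m₂ t) < 0 :=
      mul_neg_of_pos_of_neg (by linarith) (by linarith)
    nlinarith [mul_neg_of_pos_of_neg hM2 h2, sq_nonneg (t * (2 * 0 + 1) - m₁ * (0 + 1) - m₂ * 0)]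

lemma limit_density_eq {m₁ m₂ t : ℝ} (hm₁ : 0 < m₁) (hm₂ : 0 < m₂) (ht0 : 0 ≤ t)
    (htm : t < m₁ + m₂) {x : ℝ} (hx : x ∈ Set.Ioo (xMinus m₁ m₂ t) (xPlus m₁ m₂ t)) :
    (m₁ + m₂) * √((xPlus m₁ m₂ t - x) * (x - xMinus m₁ m₂ t)) / (2 * Real.pi * |x| * (1 + x)) =
      (m₁ + m₂) / (2 * Real.pi) * (√((xPlus m₁ m₂ t - x) * (x - xMinus m₁ m₂ t)) / (0 - x)
        + √((xPlus m₁ m₂ t - x) * (x - xMinus m₁ m₂ t)) / (x - (-1))) := by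
  obtain ⟨-, h1, h2, -⟩ := xMinus_xPlus_spec hm₁ hm₂ ht0 htm
  have hx0 : x < 0 := by linarith [hx.2]
  have hx1 : 0 < 1 + x := by linarith [hx.1]
  have hpi := Real.pi_pos
  rw [abs_of_neg hx0, zero_sub, sub_neg_eq_add, add_comm x 1]
  have := hx0.ne
  field_simp
  ring

lemma limit_density_nonneg {m₁ m₂ t : ℝ} (hm₁ : 0 < m₁) (hm₂ : 0 < m₂) (ht0 : 0 ≤ t)
    (htm : t < m₁ + m₂) (x : ℝ) :
    0 ≤ Set.indicator (Set.Ioo (xMinus m₁ m₂ t) (xPlus m₁ m₂ t))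
        (fun x => (m₁ + m₂) * √((xPlus m₁ m₂ t - x) * (x - xMinus m₁ m₂ t)) /
          (2 * Real.pi * |x| * (1 + x))) x := by
  obtain ⟨-, h1, h2, -⟩ := xMinus_xPlus_spec hm₁ hm₂ ht0 htm
  refine Set.indicator_nonneg (fun x hx => ?_) x
  have hx1 : 0 < 1 + x := by linarith [hx.1]
  positivity

lemma limit_density_integrable {m₁ m₂ t : ℝ} (hm₁ : 0 < m₁) (hm₂ : 0 < m₂) (ht0 : 0 ≤ t)
    (htm : t < m₁ + m₂) :
    Integrable (Set.indicator (Set.Ioo (xMinus m₁ m₂ t) (xPlus m₁ m₂ t))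
        (fun x => (m₁ + m₂) * √((xPlus m₁ m₂ t - x) * (x - xMinus m₁ m₂ t)) /
          (2 * Real.pi * |x| * (1 + x)))) := by
  obtain ⟨h0, h1, h2, -⟩ := xMinus_xPlus_spec hm₁ hm₂ ht0 htm
  rw [integrable_indicator_iff measurableSet_Ioo]
  refine IntegrableOn.congr_fun ?_ (fun x hx => (limit_density_eq hm₁ hm₂ ht0 htm hx).symm)
    measurableSet_Ioo
  have := (((semicircle_stieltjes_right h0 h2).1.add (semicircle_stieltjes_left h0 h1).1).const_mul
    ((m₁ + m₂) / (2 * Real.pi)))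
  rw [intervalIntegrable_iff_integrableOn_Ioc_of_le h0] at this
  exact this.mono_set Set.Ioo_subset_Ioc_self

lemma isFiniteMeasure_limitZeroMeasure {m₁ m₂ t : ℝ} (hm₁ : 0 < m₁) (hm₂ : 0 < m₂) (ht0 : 0 ≤ t)
    (htm : t < m₁ + m₂) : IsFiniteMeasure (limitZeroMeasure m₁ m₂ t) := by
  have := isFiniteMeasure_withDensity_ofReal (limit_density_integrable hm₁ hm₂ ht0 htm).2
  have h1 := Measure.smul_finite (Measure.dirac (0 : ℝ))
    (c := if t < m₁ then ENNReal.ofReal (m₁ - t) else 0) (by split_ifs <;> simp)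
  have h2 := Measure.smul_finite (Measure.dirac (-1 : ℝ))
    (c := if t < m₂ then ENNReal.ofReal (m₂ - t) else 0) (by split_ifs <;> simp)
  unfold limitZeroMeasure
  infer_instance

lemma ae_mem_Icc_limitZeroMeasure {m₁ m₂ t : ℝ} (hm₁ : 0 < m₁) (hm₂ : 0 < m₂) (ht0 : 0 ≤ t)
    (htm : t < m₁ + m₂) : ∀ᵐ x ∂limitZeroMeasure m₁ m₂ t, x ∈ Set.Icc (-1 : ℝ) 0 := by
  obtain ⟨-, h1, h2, -⟩ := xMinus_xPlus_spec hm₁ hm₂ ht0 htm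
  unfold limitZeroMeasure
  rw [ae_add_measure_iff, ae_add_measure_iff]
  refine ⟨⟨?_, ?_⟩, ?_⟩
  · rw [ae_withDensity_iff' (limit_density_integrable hm₁ hm₂ ht0 htm).1.aemeasurable.ennreal_ofReal]
    refine ae_of_all _ fun x hx => ?_
    by_contra hc
    refine hx ?_
    rw [Set.indicator_of_notMem, ENNReal.ofReal_zero]
    exact fun h => hc ⟨by linarith [h.1], by linarith [h.2]⟩
  · exact Measure.ae_smul_measure (by simp [ae_dirac_eq]) _
  · exact Measure.ae_smul_measure (by simp [ae_dirac_eq]) _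

/-- The Stieltjes transform of the limit measure on the positive half-line. -/
lemma integral_limitZeroMeasure {m₁ m₂ t : ℝ} (hm₁ : 0 < m₁) (hm₂ : 0 < m₂) (ht0 : 0 ≤ t)
    (htm : t < m₁ + m₂) {z : ℝ} (hz : 0 < z) :
    ∫ x, 1 / (z - x) ∂limitZeroMeasure m₁ m₂ t =
      (-(t * (2 * z + 1) - m₁ * (z + 1) - m₂ * z)
        + √((t * (2 * z + 1) - m₁ * (z + 1) - m₂ * z) ^ 2
          - 4 * (z * (z + 1)) * (t * (t - (m₁ + m₂))))) / (2 * (z * (z + 1))) := by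
  obtain ⟨h0, h1, h2, hprod⟩ := xMinus_xPlus_spec hm₁ hm₂ ht0 htm
  have hint : Integrable (fun x => 1 / (z - x)) (limitZeroMeasure m₁ m₂ t) := by
    have := isFiniteMeasure_limitZeroMeasure hm₁ hm₂ ht0 htm
    refine integrable_of_continuousOn_Icc (ae_mem_Icc_limitZeroMeasure hm₁ hm₂ ht0 htm) ?_
    refine continuousOn_const.div (by fun_prop) fun x hx => ?_
    linarith [hx.2]
  have hM : 0 < m₁ + m₂ := by positivity
  have hpi := Real.pi_pos
  have hac : ∫ x, 1 / (z - x) ∂(volume.withDensity (fun x => ENNReal.ofReal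
      (Set.indicator (Set.Ioo (xMinus m₁ m₂ t) (xPlus m₁ m₂ t))
        (fun x => (m₁ + m₂) * √((xPlus m₁ m₂ t - x) * (x - xMinus m₁ m₂ t)) /
          (2 * Real.pi * |x| * (1 + x))) x))) =
      (-|t - m₁| / z - |t - m₂| / (z + 1) + √((t * (2 * z + 1) - m₁ * (z + 1) - m₂ * z) ^ 2
          - 4 * (z * (z + 1)) * (t * (t - (m₁ + m₂)))) / (z * (z + 1))) / 2 := by
    rw [integral_withDensity_eq_integral_toReal_smul₀
      (limit_density_integrable hm₁ hm₂ ht0 htm).1.aemeasurable.ennreal_ofReal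
      (ae_of_all _ fun _ => ENNReal.ofReal_lt_top)]
    rw [integral_congr_ae (ae_of_all _ fun x => by
      rw [ENNReal.toReal_ofReal (limit_density_nonneg hm₁ hm₂ ht0 htm x), smul_eq_mul,
        ← Set.indicator_mul_left _ _ fun x => 1 / (z - x)]), integral_indicator measurableSet_Ioo,
        ← integral_Ioc_eq_integral_Ioo]
    obtain ⟨i1, e1⟩ := semicircle_stieltjes_right h0 h2
    obtain ⟨i2, e2⟩ := semicircle_stieltjes_left h0 h1
    obtain ⟨i3, e3⟩ := semicircle_stieltjes_right h0 (h2.trans hz.le)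
    have hsqrt : ∀ u v : ℝ, (m₁ + m₂) ^ 2 * u = v → √u = √v / (m₁ + m₂) := by
      rintro u _ rfl
      rw [Real.sqrt_mul (by positivity), Real.sqrt_sq hM.le, mul_div_cancel_left₀ _ hM.ne']
    rw [hsqrt _ _ (hprod z)] at e3
    rw [hsqrt ((0 - xMinus m₁ m₂ t) * (0 - xPlus m₁ m₂ t)) ((t - m₁) ^ 2)
      (by rw [hprod 0]; ring), Real.sqrt_sq_eq_abs] at e1
    rw [hsqrt ((xMinus m₁ m₂ t - -1) * (xPlus m₁ m₂ t - -1)) ((t - m₂) ^ 2)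
      (by linear_combination hprod (-1)), Real.sqrt_sq_eq_abs] at e2
    set S := √((t * (2 * z + 1) - m₁ * (z + 1) - m₂ * z) ^ 2
          - 4 * (z * (z + 1)) * (t * (t - (m₁ + m₂)))) with hS
    set α := xMinus m₁ m₂ t
    set β := xPlus m₁ m₂ t
    have hcongr : ∫ x in Set.Ioc α β, (m₁ + m₂) * √((β - x) * (x - α)) /
          (2 * Real.pi * |x| * (1 + x)) * (1 / (z - x)) =
        ∫ x in α..β, (m₁ + m₂) / (2 * Real.pi) * (1 / z * (√((β - x) * (x - α)) / (0 - x))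
          + 1 / (z + 1) * (√((β - x) * (x - α)) / (x - (-1)))
          - 1 / (z * (z + 1)) * (√((β - x) * (x - α)) / (z - x))) := by
      rw [intervalIntegral.integral_of_le h0, integral_Ioc_eq_integral_Ioo,
        integral_Ioc_eq_integral_Ioo]
      refine setIntegral_congr_fun measurableSet_Ioo fun x hx => ?_
      rw [limit_density_eq hm₁ hm₂ ht0 htm hx]
      have a1 : 0 - x ≠ 0 := by linarith [hx.2]
      have a2 : x - (-1) ≠ 0 := by linarith [hx.1]
      have a3 : z - x ≠ 0 := by linarith [hx.2]
      have key : (1 / (0 - x) + 1 / (x - (-1))) * (1 / (z - x)) =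
          1 / z * (1 / (0 - x)) + 1 / (z + 1) * (1 / (x - (-1)))
            - 1 / (z * (z + 1)) * (1 / (z - x)) := by
        field_simp
        ring
      linear_combination (m₁ + m₂) / (2 * Real.pi) * √((β - x) * (x - α)) * key
    rw [hcongr, intervalIntegral.integral_const_mul, intervalIntegral.integral_sub
      ((i1.const_mul _).add (i2.const_mul _)) (i3.const_mul _), intervalIntegral.integral_add
      (i1.const_mul _) (i2.const_mul _), intervalIntegral.integral_const_mul,
      intervalIntegral.integral_const_mul, intervalIntegral.integral_const_mul, e1, e2, e3]
    field_simp
    ring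
  unfold limitZeroMeasure at hint ⊢
  rw [integral_add_measure hint.left_of_add_measure hint.right_of_add_measure,
    integral_add_measure hint.left_of_add_measure.left_of_add_measure
      hint.left_of_add_measure.right_of_add_measure, hac, integral_smul_measure,
    integral_smul_measure, integral_dirac, integral_dirac]
  have hatom : ∀ m : ℝ, (if t < m then ENNReal.ofReal (m - t) else 0).toReal
      = (|t - m| - (t - m)) / 2 := by
    intro m
    split_ifs with h
    · rw [ENNReal.toReal_ofReal (by linarith), abs_of_neg (by linarith)]; ring
    · rw [abs_of_nonneg (by linarith)]; simp
  rw [hatom, hatom, smul_eq_mul, smul_eq_mul, sub_zero, sub_neg_eq_add]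
  field_simp
  ring

lemma integral_empRootMeasure (n : ℕ) (p : ℝ[X]) (f : ℝ → ℝ) :
    ∫ x, f x ∂empRootMeasure n p = (p.roots.map f).sum / n := by
  have key : ∀ s : Multiset ℝ, Integrable f (s.map Measure.dirac).sum ∧
      ∫ x, f x ∂(s.map Measure.dirac).sum = (s.map f).sum := by
    intro s
    induction s using Multiset.induction with
    | empty => simp
    | cons a s ih =>
      have ha : Integrable f (Measure.dirac a) := integrable_dirac (by simp)
      simp only [Multiset.map_cons, Multiset.sum_cons]
      exact ⟨ha.add_measure ih.1, by rw [integral_add_measure ha ih.1, ih.2, integral_dirac]⟩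
  rw [empRootMeasure, integral_smul_measure, (key _).2]
  simp [div_eq_inv_mul]

lemma ae_empRootMeasure (n : ℕ) (p : ℝ[X]) {P : ℝ → Prop} (h : ∀ r ∈ p.roots, P r) :
    ∀ᵐ x ∂empRootMeasure n p, P x := by
  refine Measure.ae_smul_measure ?_ _
  generalize p.roots = s at h
  induction s using Multiset.induction with
  | empty => simp
  | cons a s ih =>
    simp only [Multiset.map_cons, Multiset.sum_cons]
    rw [ae_add_measure_iff]
    exact ⟨by simpa [ae_dirac_eq] using h a (Multiset.mem_cons_self a s),
      ih fun r hr => h r (Multiset.mem_cons_of_mem hr)⟩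

lemma empRootMeasure_univ (n : ℕ) (p : ℝ[X]) :
    empRootMeasure n p Set.univ = (n : ℝ≥0∞)⁻¹ * p.roots.card := by
  rw [empRootMeasure, Measure.smul_apply, smul_eq_mul]
  congr 1
  generalize p.roots = s
  induction s using Multiset.induction with
  | empty => simp
  | cons a s ih => simp [ih, add_comm]

lemma natDegree_iterate_derivative_add (p : ℝ[X]) {k : ℕ} (hk : k ≤ p.natDegree) :
    (derivative^[k] p).natDegree + k = p.natDegree := by
  induction k with
  | zero => simp
  | succ k ih =>
    have := ih (by omega)
    rw [Function.iterate_succ_apply', natDegree_derivative]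
    omega

lemma splits_X_pow_mul_X_add_one_pow (a b : ℕ) :
    (X ^ a * (X + 1) ^ b : ℝ[X]).Splits ∧
      (X ^ a * (X + 1) ^ b : ℝ[X]).natDegree = a + b ∧
      ∀ r ∈ (X ^ a * (X + 1) ^ b : ℝ[X]).roots, r ∈ Set.Icc (-1 : ℝ) 0 := by
  have h1 : (X + 1 : ℝ[X]) = X + C 1 := by simp
  have hne : (X + C 1 : ℝ[X]) ≠ 0 := X_add_C_ne_zero 1
  rw [h1]
  refine ⟨(Splits.X.pow a).mul ((Splits.X_add_C 1).pow b), ?_, fun r hr => ?_⟩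
  · rw [natDegree_mul (pow_ne_zero _ X_ne_zero) (pow_ne_zero _ hne), natDegree_pow, natDegree_pow,
      natDegree_X, natDegree_X_add_C, mul_one, mul_one]
  · have := isRoot_of_mem_roots hr
    simp only [IsRoot.def, eval_mul, eval_pow, eval_X, eval_add, eval_C] at this
    rcases mul_eq_zero.1 this with h | h
    · rw [eq_zero_of_pow_eq_zero h]; norm_num
    · rw [eq_neg_of_add_eq_zero_left (eq_zero_of_pow_eq_zero h)]; norm_num

/-- The positive root of a quadratic equation whose constant term is nonpositive. -/
lemma eq_of_quadratic {A B D g : ℝ} (hA : 0 < A) (hD : D ≤ 0) (hg : 0 < g)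
    (h : A * g ^ 2 + B * g + D = 0) : g = (-B + √(B ^ 2 - 4 * A * D)) / (2 * A) := by
  have h1 : 0 ≤ A * g + B := by
    by_contra! hc
    nlinarith [mul_neg_of_pos_of_neg hg hc]
  have h2 : B ^ 2 - 4 * A * D = (2 * A * g + B) ^ 2 := by linear_combination (-4 * A) * h
  rw [h2, Real.sqrt_sq (by nlinarith [mul_pos hA hg])]
  field_simp
  ring

/-- The normalized logarithmic derivative of the `k`-th derivative of `x^a (x+1)^b` solves a
quadratic equation up to an error term. -/
lemma stieltjes_iterate_derivative {a b k n : ℕ} (hk : k < a + b) (hn : 0 < n) {z : ℝ}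
    (hz : 0 < z) :
    ∃ E : ℝ, 0 ≤ E ∧ E ≤ ((a : ℝ) / n + b / n) / n / z ^ 2 ∧
      ((derivative^[k] (X ^ a * (X + 1) ^ b : ℝ[X])).roots.map fun r => 1 / (z - r)).sum / n =
      (-(((k : ℝ) / n + 1 / n) * (2 * z + 1) - a / n * (z + 1) - b / n * z)
        + √((((k : ℝ) / n + 1 / n) * (2 * z + 1) - a / n * (z + 1) - b / n * z) ^ 2
          - 4 * (z * (z + 1)) * (((k : ℝ) / n + 1 / n) * (k / n - (a / n + b / n))
            - z * (z + 1) * E))) / (2 * (z * (z + 1))) := by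
  obtain ⟨hs0, hdeg, hr0⟩ := splits_X_pow_mul_X_add_one_pow a b
  obtain ⟨hs, hr⟩ := splits_and_roots_iterate_derivative hs0 hr0 k
  set p : ℝ[X] := derivative^[k] (X ^ a * (X + 1) ^ b) with hp
  have hdegp : p.natDegree + k = a + b := by
    rw [hp, natDegree_iterate_derivative_add _ (by omega), hdeg]
  have hcard : p.roots.card = p.natDegree := splits_iff_card_roots.1 hs
  have hp0 : p ≠ 0 := by
    intro h
    rw [h, natDegree_zero] at hdegp
    omega
  have hroots : p.roots ≠ 0 := by
    rw [← Multiset.card_pos, hcard]; omega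
  have hzr : ∀ r ∈ p.roots, z ≤ z - r := fun r h => by linarith [(hr r h).2]
  have hpz : p.eval z ≠ 0 := fun h => by
    have := (hr z ((mem_roots hp0).2 h)).2
    linarith
  set G := (p.roots.map fun r => 1 / (z - r)).sum with hG
  set H := (p.roots.map fun r => 1 / (z - r) ^ 2).sum with hH
  have hn' : (0 : ℝ) < n := by exact_mod_cast hn
  have hGpos : 0 < G := by
    have : (p.roots.map fun _ => (0 : ℝ)).sum < G :=
      Multiset.sum_lt_sum_of_nonempty hroots fun r h => one_div_pos.2 (by linarith [hzr r h])
    simpa using this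
  have hH0 : 0 ≤ H := by
    refine Multiset.sum_nonneg fun x hx => ?_
    obtain ⟨r, -, rfl⟩ := Multiset.mem_map.1 hx
    positivity
  have hHle : H ≤ (a + b) * (1 / z ^ 2) := by
    have h1 : H ≤ (p.roots.map fun _ => 1 / z ^ 2).sum := by
      refine Multiset.sum_map_le_sum_map _ _ fun r h => ?_
      have := hzr r h
      gcongr
    refine h1.trans ?_
    rw [Multiset.map_const', Multiset.sum_replicate, nsmul_eq_mul]
    gcongr
    have : p.roots.card ≤ a + b := by omega
    exact_mod_cast this
  have hode := congrArg (eval z) (iterate_derivative_X_pow_mul_ode a b k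
    (fun k => derivative^[k] (X ^ a * (X + 1) ^ b)) fun _ => rfl)
  simp only [Function.iterate_succ_apply', ← hp, eval_add, eval_mul, eval_sub, eval_X, eval_one,
    eval_C, eval_ofNat, eval_zero] at hode
  rw [eval_derivative_derivative_of_splits hs hpz, hs.eval_derivative_eq_eval_mul_sum hpz,
    ← hG, ← hH] at hode
  have hode' : z * (z + 1) * (G ^ 2 - H) + ((k + 1) * (2 * z + 1) - a * (z + 1) - b * z) * G
      + (k + 1) * (k - a - b) = 0 := by
    refine mul_left_cancel₀ hpz ?_
    linear_combination hode
  refine ⟨H / n ^ 2, by positivity, ?_, ?_⟩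
  · calc H / n ^ 2 ≤ (a + b) * (1 / z ^ 2) / n ^ 2 := by gcongr
      _ = _ := by field_simp
  · refine eq_of_quadratic (by positivity) ?_ (by positivity) ?_
    · have hkab : (k : ℝ) ≤ a + b := by exact_mod_cast hk.le
      have h1 : ((k : ℝ) / n + 1 / n) * (k / n - (a / n + b / n)) ≤ 0 := by
        refine mul_nonpos_of_nonneg_of_nonpos (by positivity) ?_
        rw [← add_div, ← sub_div]
        exact div_nonpos_of_nonpos_of_nonneg (by linarith) hn'.le
      have h2 : 0 ≤ z * (z + 1) * (H / n ^ 2) := by positivity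
      linarith
    · field_simp
      linear_combination hode'

/-- Let `m₁, m₂ > 0` and let `a_n/n → m₁`, `b_n/n → m₂`.  For
`Q_n(x) = x^{a_n}(x+1)^{b_n}` and every `0 ≤ t < m₁+m₂`, the empirical root measures of the
`⌊tn⌋`-th derivatives of `Q_n` converge weakly to the measure `limitZeroMeasure m₁ m₂ t`. -/
theorem stmt_15 (m₁ m₂ : ℝ) (hm₁ : 0 < m₁) (hm₂ : 0 < m₂)
    (a b : ℕ → ℕ)
    (ha : Tendsto (fun n : ℕ => (a n : ℝ) / n) atTop (nhds m₁))
    (hb : Tendsto (fun n : ℕ => (b n : ℝ) / n) atTop (nhds m₂))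
    (t : ℝ) (ht0 : 0 ≤ t) (htm : t < m₁ + m₂) :
    ∀ f : BoundedContinuousFunction ℝ ℝ,
      Tendsto
        (fun n : ℕ => ∫ x, f x ∂(empRootMeasure n
          ((⇑derivative)^[⌊t * (n : ℝ)⌋₊] (X ^ (a n) * (X + 1) ^ (b n) : Polynomial ℝ))))
        atTop (nhds (∫ x, f x ∂(limitZeroMeasure m₁ m₂ t))) := by
  intro f
  have hfin := isFiniteMeasure_limitZeroMeasure hm₁ hm₂ ht0 htm
  have hk : Tendsto (fun n : ℕ => (⌊t * (n : ℝ)⌋₊ : ℝ) / n) atTop (nhds t) :=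
    (tendsto_nat_floor_mul_div_atTop ht0).comp tendsto_natCast_atTop_atTop
  have hlt : ∀ᶠ n : ℕ in atTop, 0 < n ∧ ⌊t * (n : ℝ)⌋₊ < a n + b n := by
    filter_upwards [hk.eventually_lt (ha.add hb) htm, eventually_gt_atTop 0] with n h1 h2
    have hn : (0 : ℝ) < n := by exact_mod_cast h2
    rw [← add_div, div_lt_div_iff_of_pos_right hn] at h1
    exact ⟨h2, by exact_mod_cast h1⟩
  refine tendsto_integral_of_stieltjes (K := m₁ + m₂ + 1)
    (ae_mem_Icc_limitZeroMeasure hm₁ hm₂ ht0 htm) ?_ (fun z hz => ?_) f.continuous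
  · filter_upwards [hlt, (ha.add hb).eventually_lt_const (lt_add_one (m₁ + m₂))] with n hn hab
    obtain ⟨hs0, hdeg, hr0⟩ := splits_X_pow_mul_X_add_one_pow (a n) (b n)
    obtain ⟨hs, hr⟩ := splits_and_roots_iterate_derivative hs0 hr0 ⌊t * (n : ℝ)⌋₊
    have hn0 : (0 : ℝ) < n := by exact_mod_cast hn.1
    refine ⟨⟨?_⟩, ae_empRootMeasure _ _ hr, ?_⟩
    · rw [empRootMeasure_univ]
      exact ENNReal.mul_lt_top (by simp [hn.1]) (by simp)
    · rw [measureReal_def, empRootMeasure_univ]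
      simp only [ENNReal.toReal_mul, ENNReal.toReal_inv, ENNReal.toReal_natCast]
      refine le_trans ?_ hab.le
      rw [← add_div, inv_mul_eq_div]
      gcongr
      have h1 := card_roots' (derivative^[⌊t * (n : ℝ)⌋₊] (X ^ (a n) * (X + 1) ^ (b n) : ℝ[X]))
      have h2 := natDegree_iterate_derivative (X ^ (a n) * (X + 1) ^ (b n) : ℝ[X]) ⌊t * (n : ℝ)⌋₊
      have h3 : (derivative^[⌊t * (n : ℝ)⌋₊] (X ^ (a n) * (X + 1) ^ (b n) : ℝ[X])).roots.card
        ≤ a n + b n := by omega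
      exact_mod_cast h3
  · rw [integral_limitZeroMeasure hm₁ hm₂ ht0 htm hz]
    have hE : ∀ n : ℕ, ∃ E : ℝ, (0 < n ∧ ⌊t * (n : ℝ)⌋₊ < a n + b n) → _ := fun n => by
      by_cases h : 0 < n ∧ ⌊t * (n : ℝ)⌋₊ < a n + b n
      · obtain ⟨E, hE⟩ := stieltjes_iterate_derivative h.2 h.1 hz
        exact ⟨E, fun _ => hE⟩
      · exact ⟨0, fun h' => absurd h' h⟩
    choose E hE using hE
    have hinv : Tendsto (fun n : ℕ => (1 : ℝ) / n) atTop (nhds 0) := tendsto_one_div_atTop_nhds_zero_nat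
    have hE0 : Tendsto E atTop (nhds 0) := by
      have hup : Tendsto (fun n : ℕ => ((a n : ℝ) / n + b n / n) / n / z ^ 2) atTop (nhds 0) := by
        have := (((ha.add hb).mul hinv).div_const (z ^ 2))
        simpa [div_eq_mul_inv] using this
      exact tendsto_of_tendsto_of_tendsto_of_le_of_le' tendsto_const_nhds hup
        (hlt.mono fun n hn => (hE n hn).1) (hlt.mono fun n hn => (hE n hn).2.1)
    have hB := (((hk.add hinv).mul_const (2 * z + 1)).sub (ha.mul_const (z + 1))).sub
      (hb.mul_const z)
    have hD := ((hk.add hinv).mul (hk.sub (ha.add hb))).sub (hE0.const_mul (z * (z + 1)))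
    have hlim := (hB.neg.add ((hB.pow 2).sub (hD.const_mul (4 * (z * (z + 1))))).sqrt).div_const
      (2 * (z * (z + 1)))
    rw [add_zero, mul_zero, sub_zero] at hlim
    refine hlim.congr' ?_
    filter_upwards [hlt] with n hn
    rw [integral_empRootMeasure]
    exact (hE n hn).2.2.symm
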